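/- Collapse at the singleton interval [0,0] under strict timing: for all metric formulas φ, ψ over A, the following equivalences hold over strict timed HT-traces (writing [0,0] for the interval [0,1)): ψ U_{[0,0]} φ ≡ φ; ψ R_{[0,0]} φ ≡ φ; ○_{[0,0]} φ ≡ ⊥; •_{[0,0]} φ ≡ ⊥; ○̂_{[0,0]} φ ≡ ⊤; •̂_{[0,0]} φ ≡ ⊤. -/

import Mathlib

/-- Metric formulas over an alphabet `A`.  Each temporal operator carries an
interval `[m, n)` with `m : ℕ` and `n : ℕ∞` (where `⊤` plays the role of `ω`). -/
inductive MForm (A : Type) : Type where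
  | bot  : MForm A
  | atom : A → MForm A
  | conj : MForm A → MForm A → MForm A
  | disj : MForm A → MForm A → MForm A
  | impl : MForm A → MForm A → MForm A
  | prev  : ℕ → ℕ∞ → MForm A → MForm A
  | since : ℕ → ℕ∞ → MForm A → MForm A → MForm A
  | trig  : ℕ → ℕ∞ → MForm A → MForm A → MForm A
  | next  : ℕ → ℕ∞ → MForm A → MForm A
  | untl  : ℕ → ℕ∞ → MForm A → MForm A → MForm A
  | rel   : ℕ → ℕ∞ → MForm A → MForm A → MForm A

/-- Membership of a duration `d` in the interval `[m, n)`. -/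
def inIntv (m : ℕ) (n : ℕ∞) (d : ℕ) : Prop := m ≤ d ∧ (d : ℕ∞) < n

/-- Satisfaction `(⟨H,T⟩,τ), k ⊨ φ` for a timed HT-trace of length `len`. -/
def sat {A : Type} : MForm A → (ℕ → Set A) → (ℕ → Set A) → (ℕ → ℕ) → ℕ∞ → ℕ → Prop
  | .bot, _, _, _, _, _ => False
  | .atom p, H, _, _, _, k => p ∈ H k
  | .conj φ ψ, H, T, τ, len, k => sat φ H T τ len k ∧ sat ψ H T τ len k
  | .disj φ ψ, H, T, τ, len, k => sat φ H T τ len k ∨ sat ψ H T τ len k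
  | .impl φ ψ, H, T, τ, len, k =>
      (¬ sat φ H T τ len k ∨ sat ψ H T τ len k) ∧
      (¬ sat φ T T τ len k ∨ sat ψ T T τ len k)
  | .prev m n φ, H, T, τ, len, k =>
      0 < k ∧ sat φ H T τ len (k-1) ∧ inIntv m n (τ k - τ (k-1))
  | .since m n φ ψ, H, T, τ, len, k =>
      ∃ j, j ≤ k ∧ inIntv m n (τ k - τ j) ∧ sat ψ H T τ len j ∧
        ∀ i, j < i → i ≤ k → sat φ H T τ len i
  | .trig m n φ ψ, H, T, τ, len, k =>
      ∀ j, j ≤ k → inIntv m n (τ k - τ j) →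
        (sat ψ H T τ len j ∨ ∃ i, j < i ∧ i ≤ k ∧ sat φ H T τ len i)
  | .next m n φ, H, T, τ, len, k =>
      (k : ℕ∞) + 1 < len ∧ sat φ H T τ len (k+1) ∧ inIntv m n (τ (k+1) - τ k)
  | .untl m n φ ψ, H, T, τ, len, k =>
      ∃ j, k ≤ j ∧ (j : ℕ∞) < len ∧ inIntv m n (τ j - τ k) ∧ sat ψ H T τ len j ∧
        ∀ i, k ≤ i → i < j → sat φ H T τ len i
  | .rel m n φ ψ, H, T, τ, len, k =>
      ∀ j, k ≤ j → (j : ℕ∞) < len → inIntv m n (τ j - τ k) →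
        (sat ψ H T τ len j ∨ ∃ i, k ≤ i ∧ i < j ∧ sat φ H T τ len i)

/-- `(⟨H,T⟩,τ)` is a timed HT-trace of length `len`. -/
def isTrace {A : Type} (H T : ℕ → Set A) (τ : ℕ → ℕ) (len : ℕ∞) : Prop :=
  (∀ i : ℕ, (i : ℕ∞) < len → H i ⊆ T i) ∧
  (∀ i : ℕ, (i : ℕ∞) + 1 < len → τ i ≤ τ (i+1)) ∧
  τ 0 = 0

/-- Strict timing. -/
def isStrict (τ : ℕ → ℕ) (len : ℕ∞) : Prop :=
  ∀ i : ℕ, (i : ℕ∞) + 1 < len → τ i < τ (i+1)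

/-- Negation `¬φ := φ → ⊥`. -/
def mNeg {A : Type} (φ : MForm A) : MForm A := MForm.impl φ MForm.bot

/-- `⊤ := ¬⊥`. -/
def mTop {A : Type} : MForm A := mNeg MForm.bot

/-- Eventually `◇_I φ := ⊤ U_I φ`. -/
def mEvent {A : Type} (m : ℕ) (n : ℕ∞) (φ : MForm A) : MForm A := MForm.untl m n mTop φ

/-- Always `◻_I φ := ⊥ R_I φ`. -/
def mAlways {A : Type} (m : ℕ) (n : ℕ∞) (φ : MForm A) : MForm A := MForm.rel m n MForm.bot φ

/-- Eventually-before `◆_I φ := ⊤ S_I φ`. -/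
def mEvB {A : Type} (m : ℕ) (n : ℕ∞) (φ : MForm A) : MForm A := MForm.since m n mTop φ

/-- Always-before `■_I φ := ⊥ T_I φ`. -/
def mAlwB {A : Type} (m : ℕ) (n : ℕ∞) (φ : MForm A) : MForm A := MForm.trig m n MForm.bot φ

/-- Weak next `○̂_I φ := ○_I φ ∨ ¬○_I ⊤`. -/
def mWNext {A : Type} (m : ℕ) (n : ℕ∞) (φ : MForm A) : MForm A :=
  MForm.disj (MForm.next m n φ) (mNeg (MForm.next m n mTop))

/-- Weak previous `•̂_I φ := •_I φ ∨ ¬•_I ⊤`. -/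
def mWPrev {A : Type} (m : ℕ) (n : ℕ∞) (φ : MForm A) : MForm A :=
  MForm.disj (MForm.prev m n φ) (mNeg (MForm.prev m n mTop))

/-- MHT-equivalence over strict timed HT-traces. -/
def mhtEquivStrict {A : Type} (φ ψ : MForm A) : Prop :=
  ∀ (H T : ℕ → Set A) (τ : ℕ → ℕ) (len : ℕ∞),
    isTrace H T τ len → isStrict τ len → ∀ k : ℕ, (k : ℕ∞) < len →
      (sat φ H T τ len k ↔ sat ψ H T τ len k)

theorem inIntv_zero_one {d : ℕ} : inIntv 0 1 d ↔ d = 0 := by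
  simp [inIntv]

theorem isStrict.lt {τ : ℕ → ℕ} {len : ℕ∞} (hτ : isStrict τ len) {k j : ℕ} (hkj : k < j)
    (hj : (j : ℕ∞) < len) : τ k < τ j := by
  induction j, hkj using Nat.le_induction with
  | base => exact hτ k (by exact_mod_cast hj)
  | succ j _ ih =>
    have hj' : (j : ℕ∞) < len := lt_trans (by exact_mod_cast Nat.lt_succ_self j) hj
    exact (ih hj').trans (hτ j (by exact_mod_cast hj))

theorem isStrict.eq_of_inIntv {τ : ℕ → ℕ} {len : ℕ∞} (hτ : isStrict τ len) {k j : ℕ}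
    (hkj : k ≤ j) (hj : (j : ℕ∞) < len) (h : inIntv 0 1 (τ j - τ k)) : j = k := by
  rw [inIntv_zero_one] at h
  by_contra hne
  have := hτ.lt (lt_of_le_of_ne hkj (Ne.symm hne)) hj
  omega

theorem not_sat_next_zero_one {A : Type} (φ : MForm A) (H T : ℕ → Set A) {τ : ℕ → ℕ}
    {len : ℕ∞} (hτ : isStrict τ len) (k : ℕ) : ¬ sat (MForm.next 0 1 φ) H T τ len k := by
  rintro ⟨hk, -, hI⟩
  have := hτ.eq_of_inIntv (Nat.le_succ k) (by exact_mod_cast hk) hI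
  omega

theorem not_sat_prev_zero_one {A : Type} (φ : MForm A) (H T : ℕ → Set A) {τ : ℕ → ℕ}
    {len : ℕ∞} (hτ : isStrict τ len) {k : ℕ} (hk : (k : ℕ∞) < len) :
    ¬ sat (MForm.prev 0 1 φ) H T τ len k := by
  rintro ⟨h0, -, hI⟩
  have := hτ.eq_of_inIntv (Nat.sub_le k 1) hk hI
  omega

theorem sat_mTop {A : Type} (H T : ℕ → Set A) (τ : ℕ → ℕ) (len : ℕ∞) (k : ℕ) :
    sat mTop H T τ len k :=
  ⟨Or.inl id, Or.inl id⟩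

/-- Collapse at the singleton interval `[0,0] = [0,1)` under strict timing. -/
theorem singleton_zero_collapse {A : Type} (φ ψ : MForm A) :
    mhtEquivStrict (MForm.untl 0 1 ψ φ) φ ∧
    mhtEquivStrict (MForm.rel 0 1 ψ φ) φ ∧
    mhtEquivStrict (MForm.next 0 1 φ) MForm.bot ∧
    mhtEquivStrict (MForm.prev 0 1 φ) MForm.bot ∧
    mhtEquivStrict (mWNext 0 1 φ) mTop ∧
    mhtEquivStrict (mWPrev 0 1 φ) mTop := by
  refine ⟨?_, ?_, ?_, ?_, ?_, ?_⟩ <;> intro H T τ len _ hτ k hk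
  · constructor
    · rintro ⟨j, hkj, hj, hI, hφ, -⟩
      rwa [hτ.eq_of_inIntv hkj hj hI] at hφ
    · intro hφ
      exact ⟨k, le_rfl, hk, inIntv_zero_one.2 (Nat.sub_self _), hφ,
        fun i hki hik => absurd hik hki.not_gt⟩
  · constructor
    · intro h
      rcases h k le_rfl hk (inIntv_zero_one.2 (Nat.sub_self _)) with hφ | ⟨i, hki, hik, -⟩
      · exact hφ
      · exact absurd hik hki.not_gt
    · intro hφ j hkj hj hI
      rw [hτ.eq_of_inIntv hkj hj hI]
      exact Or.inl hφ
  · exact iff_of_false (not_sat_next_zero_one φ H T hτ k) id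
  · exact iff_of_false (not_sat_prev_zero_one φ H T hτ hk) id
  · exact iff_of_true (Or.inr ⟨Or.inl (not_sat_next_zero_one mTop H T hτ k),
      Or.inl (not_sat_next_zero_one mTop T T hτ k)⟩) (sat_mTop H T τ len k)
  · exact iff_of_true (Or.inr ⟨Or.inl (not_sat_prev_zero_one mTop H T hτ hk),
      Or.inl (not_sat_prev_zero_one mTop T T hτ hk)⟩) (sat_mTop H T τ len k)
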